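/- Let Ω be an n×n real matrix with Ω_{j k} ≥ 0 for all j ≠ k and all column sums zero, with basins N_1, …, N_{n_B} and N_B their union, stationary basin vectors Λ_{η,∞}, and pruned-forest vectors κ'_η with pruned-forest total weight F' and attachment weights F'_{η,l}. Let Λ_0 ∈ ℝⁿ. Then F' > 0, and setting c_η := ∑_{j ∈ N_η} (Λ_0)_j + (∑_{l ∉ N_B} F'_{η,l} · (Λ_0)_l) / F', the vector Λ_∞ := ∑_{η=1}^{n_B} c_η Λ_{η,∞} satisfies κ'_η · Λ_∞ = κ'_η · Λ_0 for every η = 1, …, n_B. -/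

import Mathlib

open Matrix
open scoped Classical

/-- Edge of the digraph `G_Ω`: for `k ≠ j`, there is an edge from `k` to `j` iff `Ω j k ≠ 0`. -/
def edgeRel {n : ℕ} (Ω : Matrix (Fin n) (Fin n) ℝ) (k j : Fin n) : Prop :=
  k ≠ j ∧ Ω j k ≠ 0

/-- Reachability in `G_Ω`: the reflexive-transitive closure of the edge relation. -/
def reaches {n : ℕ} (Ω : Matrix (Fin n) (Fin n) ℝ) : Fin n → Fin n → Prop :=
  Relation.ReflTransGen (edgeRel Ω)

/-- `S` is a strongly connected component of `G_Ω`. -/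
def IsSCC {n : ℕ} (Ω : Matrix (Fin n) (Fin n) ℝ) (S : Set (Fin n)) : Prop :=
  S.Nonempty ∧ ∀ u ∈ S, ∀ v : Fin n, (v ∈ S ↔ (reaches Ω u v ∧ reaches Ω v u))

/-- A basin: a strongly connected component with no outgoing edges. -/
def IsBasin {n : ℕ} (Ω : Matrix (Fin n) (Fin n) ℝ) (S : Set (Fin n)) : Prop :=
  IsSCC Ω S ∧ ∀ j ∈ S, ∀ k : Fin n, k ∉ S → Ω k j = 0

/-- `N_B`: the union of all basins of `G_Ω`. -/
def basinUnion {n : ℕ} (Ω : Matrix (Fin n) (Fin n) ℝ) : Set (Fin n) :=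
  {j | ∃ S : Set (Fin n), IsBasin Ω S ∧ j ∈ S}

/-- A parent function encoding a rooted spanning tree of the subset `S` with root `r`. -/
def IsTreeOn {n : ℕ} (S : Set (Fin n)) (r : Fin n) (p : Fin n → Fin n) : Prop :=
  p r = r ∧ (∀ v : Fin n, v ∉ S → p v = v) ∧ (∀ v ∈ S, p v ∈ S) ∧
    ∀ v ∈ S, ∃ m : ℕ, p^[m] v = r

/-- `t_{S,r}`: the total weight of all rooted spanning trees of `S` with root `r`. -/
noncomputable def treeOnSum {n : ℕ} (Ω : Matrix (Fin n) (Fin n) ℝ) (S : Set (Fin n))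
    (r : Fin n) : ℝ :=
  ∑ p ∈ Finset.univ.filter (fun p : Fin n → Fin n => IsTreeOn S r p),
    ∏ v ∈ Finset.univ.filter (fun v => v ∈ S ∧ v ≠ r), Ω (p v) v

/-- `T_S = ∑_{r ∈ S} t_{S,r}`. -/
noncomputable def basinTotal {n : ℕ} (Ω : Matrix (Fin n) (Fin n) ℝ) (S : Set (Fin n)) : ℝ :=
  ∑ r ∈ Finset.univ.filter (fun r : Fin n => r ∈ S), treeOnSum Ω S r

/-- The stationary vector `Λ_{S,∞}` of a basin `S`. -/
noncomputable def statVec {n : ℕ} (Ω : Matrix (Fin n) (Fin n) ℝ) (S : Set (Fin n)) :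
    Fin n → ℝ :=
  fun j => if j ∈ S then treeOnSum Ω S j / basinTotal Ω S else 0

/-- A parent function encoding a forest of `Fin n` rooted in `N_B`. -/
def IsForest {n : ℕ} (Ω : Matrix (Fin n) (Fin n) ℝ) (p : Fin n → Fin n) : Prop :=
  (∀ v : Fin n, p v = v → v ∈ basinUnion Ω) ∧
    ∀ v : Fin n, ∃ m : ℕ, p (p^[m] v) = p^[m] v

/-- A pruned forest: every vertex of `N_B` is a fixed point. -/
def IsPrunedForest {n : ℕ} (Ω : Matrix (Fin n) (Fin n) ℝ) (p : Fin n → Fin n) : Prop :=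
  IsForest Ω p ∧ ∀ v ∈ basinUnion Ω, p v = v

/-- The weight of a forest. -/
noncomputable def forestWt {n : ℕ} (Ω : Matrix (Fin n) (Fin n) ℝ) (p : Fin n → Fin n) : ℝ :=
  ∏ v ∈ Finset.univ.filter (fun v : Fin n => p v ≠ v), Ω (p v) v

/-- The forest `p` attaches the vertex `l` to the basin `S`. -/
def attachesTo {n : ℕ} (p : Fin n → Fin n) (S : Set (Fin n)) (l : Fin n) : Prop :=
  ∃ m : ℕ, p^[m] l ∈ S

/-- `F'`: the total weight of all pruned forests. -/
noncomputable def prunedTotal {n : ℕ} (Ω : Matrix (Fin n) (Fin n) ℝ) : ℝ :=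
  ∑ p ∈ Finset.univ.filter (fun p : Fin n → Fin n => IsPrunedForest Ω p), forestWt Ω p

/-- `F'_{η,l}`: the total weight of the pruned forests attaching `l` to basin `S`. -/
noncomputable def prunedAttach {n : ℕ} (Ω : Matrix (Fin n) (Fin n) ℝ) (S : Set (Fin n))
    (l : Fin n) : ℝ :=
  ∑ p ∈ Finset.univ.filter
      (fun p : Fin n → Fin n => IsPrunedForest Ω p ∧ attachesTo p S l),
    forestWt Ω p

/-- The constraint vector `κ'_η` associated with the basin `S`. -/
noncomputable def kappaP {n : ℕ} (Ω : Matrix (Fin n) (Fin n) ℝ) (S : Set (Fin n)) :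
    Fin n → ℝ :=
  fun j => if j ∈ S then prunedTotal Ω
    else if j ∈ basinUnion Ω then 0 else prunedAttach Ω S j

/-- If every vertex reaches `R` along `r`, there is a parent function that fixes `R`, follows
`r`-edges outside `R`, and iterates every vertex into `R`. -/
theorem exists_parent_of_reflTransGen {α : Type*} (r : α → α → Prop) (R : Set α)
    (h : ∀ v, ∃ w ∈ R, Relation.ReflTransGen r v w) :
    ∃ p : α → α, (∀ v ∈ R, p v = v) ∧ (∀ v, v ∉ R → r v (p v)) ∧ ∀ v, ∃ m : ℕ, p^[m] v ∈ R := by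
  let D : ℕ → Set α := Nat.rec (motive := fun _ => Set α) R fun _ T => {v | ∃ w ∈ T, r v w}
  have hD : ∀ v, ∃ m, v ∈ D m := by
    intro v
    obtain ⟨w, hw, hvw⟩ := h v
    induction hvw using Relation.ReflTransGen.head_induction_on with
    | refl => exact ⟨0, hw⟩
    | head hab _ ih =>
      obtain ⟨m, hm⟩ := ih
      exact ⟨m + 1, _, hm, hab⟩
  have hstep : ∀ v, v ∉ R → ∃ w, r v w ∧ Nat.find (hD w) < Nat.find (hD v) := by
    intro v hv
    obtain ⟨m, hm⟩ : ∃ m, Nat.find (hD v) = m := ⟨_, rfl⟩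
    have hvm : v ∈ D m := hm ▸ Nat.find_spec (hD v)
    cases m with
    | zero => exact absurd hvm hv
    | succ m =>
      obtain ⟨w, hw, hvw⟩ := hvm
      exact ⟨w, hvw, by rw [hm]; exact Nat.lt_succ_of_le (Nat.find_min' (hD w) hw)⟩
  choose! f hf using hstep
  refine ⟨fun v => if v ∈ R then v else f v, fun v hv => if_pos hv, fun v hv => ?_, fun v => ?_⟩
  · simpa only [if_neg hv] using (hf v hv).1
  · induction hk : Nat.find (hD v) using Nat.strong_induction_on generalizing v with
    | _ k ih =>
      by_cases hv : v ∈ R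
      · exact ⟨0, hv⟩
      · obtain ⟨m, hm⟩ := ih _ (hk ▸ (hf v hv).2) (f v) rfl
        exact ⟨m + 1, by simpa only [Function.iterate_succ_apply, if_neg hv] using hm⟩

section

variable {n : ℕ} {Ω : Matrix (Fin n) (Fin n) ℝ} {S T : Set (Fin n)}

theorem IsBasin.subset_basinUnion (hS : IsBasin Ω S) : S ⊆ basinUnion Ω :=
  fun _ hj => ⟨S, hS, hj⟩

theorem IsBasin.eq_of_mem {j : Fin n} (hS : IsBasin Ω S) (hT : IsBasin Ω T)
    (hjS : j ∈ S) (hjT : j ∈ T) : S = T := by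
  ext v
  rw [hS.1.2 j hjS v, hT.1.2 j hjT v]

/-- Every vertex reaches some basin. -/
theorem exists_basinUnion_reaches (Ω : Matrix (Fin n) (Fin n) ℝ) (v : Fin n) :
    ∃ w ∈ basinUnion Ω, reaches Ω v w := by
  obtain ⟨u, hvu, hmin⟩ := exists_minimalFor_of_wellFoundedLT (fun u => reaches Ω v u)
    (fun u => {w | reaches Ω u w}) ⟨v, Relation.ReflTransGen.refl⟩
  have hback : ∀ w, reaches Ω u w → reaches Ω w u := fun w huw =>
    hmin (hvu.trans huw) (fun x hx => huw.trans hx) (Relation.ReflTransGen.refl : reaches Ω u u)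
  refine ⟨u, ⟨{w | reaches Ω u w}, ⟨⟨⟨u, Relation.ReflTransGen.refl⟩, ?_⟩, ?_⟩,
    Relation.ReflTransGen.refl⟩, hvu⟩
  · exact fun x hx y => ⟨fun hy => ⟨(hback x hx).trans hy, (hback y hy).trans hx⟩,
      fun hy => Relation.ReflTransGen.trans hx hy.1⟩
  · intro j hj k hk
    by_contra hne
    refine hk (Relation.ReflTransGen.tail hj ⟨?_, hne⟩)
    rintro rfl
    exact hk hj

theorem edgeRel.pos (hoff : ∀ j k : Fin n, j ≠ k → 0 ≤ Ω j k) {k j : Fin n}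
    (h : edgeRel Ω k j) : 0 < Ω j k :=
  lt_of_le_of_ne (hoff j k h.1.symm) h.2.symm

theorem forestWt_nonneg (hoff : ∀ j k : Fin n, j ≠ k → 0 ≤ Ω j k) (p : Fin n → Fin n) :
    0 ≤ forestWt Ω p :=
  Finset.prod_nonneg fun _ hv => hoff _ _ (Finset.mem_filter.1 hv).2

theorem prunedTotal_pos (hoff : ∀ j k : Fin n, j ≠ k → 0 ≤ Ω j k) : 0 < prunedTotal Ω := by
  obtain ⟨p, hfix, hedge, hiter⟩ :=
    exists_parent_of_reflTransGen (edgeRel Ω) (basinUnion Ω) (exists_basinUnion_reaches Ω)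
  have hmem : ∀ v, p v = v → v ∈ basinUnion Ω := fun v hv => by
    by_contra h
    exact (hedge v h).1 hv.symm
  refine Finset.sum_pos' (fun p _ => forestWt_nonneg hoff p) ⟨p, ?_, ?_⟩
  · exact Finset.mem_filter.2 ⟨Finset.mem_univ _,
      ⟨hmem, fun v => (hiter v).imp fun m hm => hfix _ hm⟩, hfix⟩
  · exact Finset.prod_pos fun v hv =>
      (hedge v fun h => (Finset.mem_filter.1 hv).2 (hfix v h)).pos hoff

theorem IsTreeOn.parent_ne {r v : Fin n} {p : Fin n → Fin n} (hp : IsTreeOn S r p)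
    (hv : v ∈ S) (hvr : v ≠ r) : p v ≠ v := by
  intro h
  obtain ⟨m, hm⟩ := hp.2.2.2 v hv
  exact hvr (Function.iterate_fixed h m ▸ hm)

theorem IsBasin.treeOnSum_pos (hoff : ∀ j k : Fin n, j ≠ k → 0 ≤ Ω j k) (hS : IsBasin Ω S)
    {r : Fin n} (hr : r ∈ S) : 0 < treeOnSum Ω S r := by
  obtain ⟨p, hfix, hedge, hiter⟩ :=
    exists_parent_of_reflTransGen (edgeRel Ω) {v | v ∈ S → v = r} (by
      intro v
      by_cases hv : v ∈ S
      · exact ⟨r, fun _ => rfl, ((hS.1.2 v hv r).1 hr).1⟩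
      · exact ⟨v, fun h => absurd h hv, Relation.ReflTransGen.refl⟩)
  have hmaps : ∀ v ∈ S, p v ∈ S := by
    intro v hv
    by_cases hvr : v = r
    · rwa [hfix v fun _ => hvr]
    · by_contra h
      exact (hedge v fun h' => hvr (h' hv)).2 (hS.2 v hv _ h)
  refine Finset.sum_pos' (fun q hq => Finset.prod_nonneg fun v hv => ?_) ⟨p, ?_, ?_⟩
  · obtain ⟨hvS, hvr⟩ := (Finset.mem_filter.1 hv).2
    exact hoff _ _ ((Finset.mem_filter.1 hq).2.parent_ne hvS hvr)
  · refine Finset.mem_filter.2 ⟨Finset.mem_univ _, hfix r fun _ => rfl,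
      fun v hv => hfix v fun h => absurd h hv, hmaps, fun v hv => (hiter v).imp fun m hm => ?_⟩
    exact hm (Set.MapsTo.iterate (s := S) hmaps m hv)
  · refine Finset.prod_pos fun v hv => (hedge v fun h => ?_).pos hoff
    obtain ⟨hvS, hvr⟩ := (Finset.mem_filter.1 hv).2
    exact hvr (h hvS)

theorem IsBasin.basinTotal_pos (hoff : ∀ j k : Fin n, j ≠ k → 0 ≤ Ω j k) (hS : IsBasin Ω S) :
    0 < basinTotal Ω S :=
  Finset.sum_pos (fun _ hr => hS.treeOnSum_pos hoff (Finset.mem_filter.1 hr).2)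
    (hS.1.1.imp fun _ hr => Finset.mem_filter.2 ⟨Finset.mem_univ _, hr⟩)

theorem IsBasin.sum_statVec (hoff : ∀ j k : Fin n, j ≠ k → 0 ≤ Ω j k) (hS : IsBasin Ω S) :
    ∑ j, statVec Ω S j = 1 := by
  simp only [statVec]
  rw [← Finset.sum_filter, ← Finset.sum_div]
  exact div_self (ne_of_gt (hS.basinTotal_pos hoff))

/-- The constraint vectors, divided by the pruned total, are dual to the stationary vectors. -/
theorem IsBasin.sum_kappaP_mul_statVec (hoff : ∀ j k : Fin n, j ≠ k → 0 ≤ Ω j k)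
    (hS : IsBasin Ω S) (hT : IsBasin Ω T) :
    ∑ j, kappaP Ω S j * statVec Ω T j = if T = S then prunedTotal Ω else 0 := by
  split_ifs with h
  · subst h
    rw [← mul_one (prunedTotal Ω), ← hT.sum_statVec hoff, Finset.mul_sum]
    refine Finset.sum_congr rfl fun j _ => ?_
    by_cases hj : j ∈ T <;> simp [kappaP, statVec, hj]
  · refine Finset.sum_eq_zero fun j _ => ?_
    by_cases hjT : j ∈ T
    · have hjS : j ∉ S := fun hjS => h (hT.eq_of_mem hS hjT hjS)
      simp [kappaP, hjS, hT.subset_basinUnion hjT]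
    · simp [statVec, hjT]

theorem IsBasin.sum_kappaP_mul (hS : IsBasin Ω S) (x : Fin n → ℝ) :
    ∑ j, kappaP Ω S j * x j =
      prunedTotal Ω * (∑ j ∈ Finset.univ.filter (fun j : Fin n => j ∈ S), x j) +
        ∑ l ∈ Finset.univ.filter (fun l : Fin n => l ∉ basinUnion Ω),
          prunedAttach Ω S l * x l := by
  rw [Finset.mul_sum, Finset.sum_filter, Finset.sum_filter, ← Finset.sum_add_distrib]
  refine Finset.sum_congr rfl fun j _ => ?_
  by_cases hj : j ∈ S
  · simp [kappaP, hj, hS.subset_basinUnion hj]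
  · by_cases hB : j ∈ basinUnion Ω <;> simp [kappaP, hj, hB]

end

theorem stmt10 (n : ℕ) (Ω : Matrix (Fin n) (Fin n) ℝ)
    (hoff : ∀ j k : Fin n, j ≠ k → 0 ≤ Ω j k)
    (hcol : ∀ k : Fin n, ∑ j, Ω j k = 0)
    (Λ0 : Fin n → ℝ) :
    0 < prunedTotal Ω ∧
    ∀ S : Set (Fin n), IsBasin Ω S →
      (∑ j, kappaP Ω S j *
        (∑ η : {S' : Set (Fin n) // IsBasin Ω S'},
          (((∑ j' ∈ Finset.univ.filter (fun j' : Fin n => j' ∈ η.1), Λ0 j') +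
            (∑ l ∈ Finset.univ.filter (fun l : Fin n => l ∉ basinUnion Ω),
              prunedAttach Ω η.1 l * Λ0 l) / prunedTotal Ω) • statVec Ω η.1)) j) =
      ∑ j, kappaP Ω S j * Λ0 j := by
  have hF := prunedTotal_pos hoff
  refine ⟨hF, fun S hS => ?_⟩
  rw [hS.sum_kappaP_mul Λ0]
  simp only [Finset.sum_apply, Pi.smul_apply, smul_eq_mul, Finset.mul_sum]
  rw [Finset.sum_comm]
  simp only [mul_left_comm (kappaP Ω S _), ← Finset.mul_sum]
  rw [Finset.sum_eq_single ⟨S, hS⟩]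
  · rw [hS.sum_kappaP_mul_statVec hoff hS, if_pos rfl]
    field_simp
  · intro η _ hη
    rw [hS.sum_kappaP_mul_statVec hoff η.2, if_neg fun h => hη (Subtype.ext h), mul_zero]
  · exact fun h => absurd (Finset.mem_univ _) h
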